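/- arXiv:gr-qc/9311010 — 2 statements merged into one kernel-verified Lean document; each statement's English description precedes it below -/
import Mathlib

section
/- Let n be a natural number and for g = (g₁, …, gₙ) ∈ SU(2)ⁿ let φ_g : FreeGroup(Fin n) → SU(2) denote the unique group homomorphism sending the i-th generator to g_i. Consider the star-subalgebra of the C*-algebra C(SU(2)ⁿ, ℂ) of continuous complex-valued functions on SU(2)ⁿ generated by the functions g ↦ Tr(φ_g(w)), for w ranging over FreeGroup(Fin n). The closure of this star-subalgebra in the uniform (sup) norm equals the set of all continuous functions f : SU(2)ⁿ → ℂ that are invariant under simultaneous conjugation, i.e. f(u⁻¹g₁u, …, u⁻¹gₙu) = f(g₁, …, gₙ) for all u ∈ SU(2) and all (g₁, …, gₙ) ∈ SU(2)ⁿ. -/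
set_option synthInstance.maxHeartbeats 1000000
set_option maxHeartbeats 1000000

/-- `SU2` is the special unitary group SU(2): the group of 2×2 complex unitary
matrices with determinant 1, realized as a subgroup of the unitary group. -/
def SU2 : Subgroup (Matrix.unitaryGroup (Fin 2) ℂ) where
  carrier := {A | (A : Matrix (Fin 2) (Fin 2) ℂ).det = 1}
  one_mem' := by simp
  mul_mem' := by
    intro a b ha hb
    simp only [Set.mem_setOf_eq] at *
    show ((a : Matrix (Fin 2) (Fin 2) ℂ) * (b : Matrix (Fin 2) (Fin 2) ℂ)).det = 1
    rw [Matrix.det_mul, ha, hb, one_mul]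
  inv_mem' := by
    intro a ha
    simp only [Set.mem_setOf_eq] at *
    show ((a⁻¹ : Matrix.unitaryGroup (Fin 2) ℂ) : Matrix (Fin 2) (Fin 2) ℂ).det = 1
    rw [Matrix.UnitaryGroup.inv_val, Matrix.star_eq_conjTranspose, Matrix.det_conjTranspose, ha,
      star_one]

/-- The underlying 2×2 complex matrix of an element of SU(2). -/
def SU2.toMatrix (g : SU2) : Matrix (Fin 2) (Fin 2) ℂ := g.val.val

/-- The trace of (the matrix of) an element of SU(2). -/
noncomputable def SU2.trace (g : SU2) : ℂ := Matrix.trace (SU2.toMatrix g)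

open scoped Quaternion in
/-- Two representations of a monoid by unit quaternions with the same character admit a nonzero
intertwiner. -/
theorem Quaternion.exists_intertwiner_of_re_eq {Γ : Type*} [Monoid Γ] (φ ψ : Γ →* ℍ)
    (hφ : ∀ γ, ‖φ γ‖ = 1) (hψ : ∀ γ, ‖ψ γ‖ = 1) (hre : ∀ γ, (φ γ).re = (ψ γ).re) :
    ∃ u : ℍ, u ≠ 0 ∧ ∀ γ, φ γ * u = u * ψ γ := by
  let D : Submodule ℝ (WithLp 2 (ℍ × ℍ)) :=
    Submodule.span ℝ (Set.range fun γ => WithLp.toLp 2 (φ γ, ψ γ))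
  have hD : ∀ a ∈ D, a.fst.re = a.snd.re := fun a ha => by
    induction ha using Submodule.span_induction with
    | mem a h => obtain ⟨γ, rfl⟩ := h; exact hre γ
    | zero => rfl
    | add a b _ _ h₁ h₂ => simp [h₁, h₂]
    | smul r a _ h => simp [h]
  let B (x : ℍ) : D →ₗ[ℝ] D →ₗ[ℝ] ℍ :=
    LinearMap.mk₂ ℝ (fun a b => a.1.fst * x * star b.1.snd)
      (by intros; simp [add_mul]) (by intros; simp) (by intros; simp [mul_add])
      (by intros; simp)
  let T (x : ℍ) : ℍ :=
    TensorProduct.lift (B x) (InnerProductSpace.canonicalCovariantTensor D)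
  have hT (x : ℍ) {ι : Type} [Fintype ι] (v : OrthonormalBasis ι ℝ D) :
      T x = ∑ i, (v i).1.fst * x * star (v i).1.snd := by
    simp only [T, InnerProductSpace.canonicalCovariantTensor_eq_sum D v, map_sum,
      TensorProduct.lift.tmul]
    rfl
  let v := stdOrthonormalBasis ℝ D
  have hinv (x : ℍ) (γ : Γ) : φ γ * T x * star (ψ γ) = T x := by
    let L₀ : WithLp 2 (ℍ × ℍ) →ₗ[ℝ] WithLp 2 (ℍ × ℍ) :=
      { toFun := fun a => WithLp.toLp 2 (φ γ * a.fst, ψ γ * a.snd)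
        map_add' := fun a b => by simp [mul_add, ← WithLp.toLp_add]
        map_smul' := fun r a => by simp [← WithLp.toLp_smul] }
    have hL₀_apply (a) : L₀ a = WithLp.toLp 2 (φ γ * a.fst, ψ γ * a.snd) := rfl
    have hL₀ : ∀ a ∈ D, L₀ a ∈ D := fun a ha => by
      induction ha using Submodule.span_induction with
      | mem a h =>
        obtain ⟨δ, rfl⟩ := h
        exact Submodule.subset_span ⟨γ * δ, by simp [hL₀_apply]⟩
      | zero => simp
      | add a b _ _ h₁ h₂ => rw [map_add]; exact D.add_mem h₁ h₂
      | smul r a _ h => rw [map_smul]; exact D.smul_mem r h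
    let L : D →ₗᵢ[ℝ] D :=
      { toLinearMap := L₀.restrict hL₀
        norm_map' := fun a => by
          rw [← sq_eq_sq₀ (norm_nonneg _) (norm_nonneg _)]
          simp [hL₀_apply, WithLp.prod_norm_sq_eq_of_L2, hφ, hψ] }
    conv_lhs => rw [hT x v, Finset.mul_sum, Finset.sum_mul]
    rw [hT x (v.map (L.toLinearIsometryEquiv rfl))]
    refine Finset.sum_congr rfl fun i _ => ?_
    have : ((v.map (L.toLinearIsometryEquiv rfl)) i).1
        = WithLp.toLp 2 (φ γ * (v i).1.fst, ψ γ * (v i).1.snd) := rfl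
    rw [this]
    simp [mul_assoc]
  have hne : ∃ x, T x ≠ 0 := by
    by_contra! h
    obtain ⟨qI, hI⟩ : ∃ q : ℍ, q.re = 0 ∧ q.imI = 1 ∧ q.imJ = 0 ∧ q.imK = 0 :=
      ⟨⟨0, 1, 0, 0⟩, rfl, rfl, rfl, rfl⟩
    obtain ⟨qJ, hJ⟩ : ∃ q : ℍ, q.re = 0 ∧ q.imI = 0 ∧ q.imJ = 1 ∧ q.imK = 0 :=
      ⟨⟨0, 0, 1, 0⟩, rfl, rfl, rfl, rfl⟩
    obtain ⟨qK, hK⟩ : ∃ q : ℍ, q.re = 0 ∧ q.imI = 0 ∧ q.imJ = 0 ∧ q.imK = 1 :=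
      ⟨⟨0, 0, 0, 1⟩, rfl, rfl, rfl, rfl⟩
    have key (a b : ℍ) : (a * 1 * star b * star 1 + a * qI * star b * star qI
        + a * qJ * star b * star qJ + a * qK * star b * star qK).re = 4 * (a.re * b.re) := by
      simp [hI, hJ, hK]
      ring
    have hsum : ∑ i, 4 * ((v i).1.fst.re * (v i).1.snd.re) = 0 := by
      have hre_sum (f : Fin (Module.finrank ℝ D) → ℍ) : (∑ i, f i).re = ∑ i, (f i).re :=
        map_sum (⟨⟨fun q : ℍ => q.re, rfl⟩, fun _ _ => rfl⟩ : ℍ →+ ℝ) f Finset.univ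
      simp_rw [← key]
      rw [← hre_sum]
      simp only [Finset.sum_add_distrib, ← Finset.sum_mul, ← hT _ v, h]
      simp
    have hzero (i) : (v i).1.fst.re = 0 := by
      have h0 := (Finset.sum_eq_zero_iff_of_nonneg (fun i _ => by
        rw [← hD _ (v i).2]; nlinarith [mul_self_nonneg (v i).1.fst.re])).1 hsum i
        (Finset.mem_univ i)
      rw [← hD _ (v i).2] at h0
      nlinarith
    let ρ : D →ₗ[ℝ] ℝ :=
      { toFun := fun a => a.1.fst.re
        map_add' := fun a b => by simp
        map_smul' := fun r a => by simp }
    have hρ_apply (a) : ρ a = a.1.fst.re := rfl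
    have hρ : ρ = 0 := v.toBasis.ext fun i => by simpa [hρ_apply] using hzero i
    have h1 := LinearMap.congr_fun hρ
      ⟨WithLp.toLp 2 (φ 1, ψ 1), Submodule.subset_span ⟨1, rfl⟩⟩
    simp [hρ_apply] at h1
  obtain ⟨x, hx⟩ := hne
  refine ⟨T x, hx, fun γ => ?_⟩
  have h1 : star (ψ γ) * ψ γ = 1 := by
    rw [Quaternion.star_mul_self, Quaternion.normSq_eq_norm_mul_self, hψ]; simp
  calc φ γ * T x = φ γ * T x * (star (ψ γ) * ψ γ) := by rw [h1, mul_one]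
    _ = T x * ψ γ := by rw [← mul_assoc, hinv]

/-- A form of the Stone–Weierstrass theorem: a continuous function which identifies all points
identified by a star-subalgebra lies in the closure of this star-subalgebra. -/
theorem ContinuousMap.mem_closure_starSubalgebra {X : Type*} [TopologicalSpace X] [CompactSpace X]
    (A : StarSubalgebra ℂ C(X, ℂ)) (f : C(X, ℂ))
    (hf : ∀ x y, (∀ a ∈ A, a x = a y) → f x = f y) : f ∈ closure (A : Set C(X, ℂ)) := by
  let q₀ : X → A → ℂ := fun x a => a.1 x
  have hq₀ : Continuous q₀ := continuous_pi fun a => a.1.continuous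
  let q : C(X, Set.range q₀) := ⟨Set.rangeFactorization q₀, hq₀.subtype_mk _⟩
  have hq : Topology.IsQuotientMap q :=
    Topology.IsQuotientMap.of_surjective_continuous Set.rangeFactorization_surjective q.continuous
  have hqf : Function.FactorsThrough f q := fun x y hxy =>
    hf x y fun a ha => congr_fun (congr_arg Subtype.val hxy) ⟨a, ha⟩
  have : CompactSpace (Set.range q₀) := isCompact_iff_compactSpace.1 (isCompact_range hq₀)
  let F : C(Set.range q₀, ℂ) →⋆ₐ[ℂ] C(X, ℂ) := ContinuousMap.compStarAlgHom' ℂ ℂ q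
  have htop : (A.comap F).topologicalClosure = ⊤ := by
    refine ContinuousMap.starSubalgebra_topologicalClosure_eq_top_of_separatesPoints _ ?_
    intro y z hyz
    obtain ⟨a, ha⟩ : ∃ a, y.1 a ≠ z.1 a := by
      by_contra! h
      exact hyz (Subtype.ext (funext h))
    exact ⟨fun y => y.1 a,
      ⟨⟨fun y => y.1 a, (continuous_apply a).comp continuous_subtype_val⟩, a.2, rfl⟩, ha⟩
  have hmem : hq.lift f hqf ∈
      closure ((A.comap F : StarSubalgebra ℂ _) : Set C(Set.range q₀, ℂ)) := by
    rw [← StarSubalgebra.topologicalClosure_coe, htop]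
    trivial
  have := map_mem_closure (ContinuousMap.continuous_precomp q) hmem (t := (A : Set C(X, ℂ)))
    fun a ha => ha
  rwa [hq.lift_comp] at this

namespace SU2

open scoped Quaternion

theorem toMatrix_one : toMatrix 1 = 1 := rfl

theorem toMatrix_mul (g h : SU2) : toMatrix (g * h) = toMatrix g * toMatrix h := rfl

theorem toMatrix_injective : Function.Injective toMatrix :=
  Subtype.val_injective.comp Subtype.val_injective

theorem det_toMatrix (g : SU2) : (toMatrix g).det = 1 := g.2

theorem star_toMatrix (g : SU2) : star (toMatrix g) = (toMatrix g).adjugate := by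
  have h : star (toMatrix g) * toMatrix g = 1 := Matrix.mem_unitaryGroup_iff'.1 g.1.2
  calc star (toMatrix g) = star (toMatrix g) * (toMatrix g * (toMatrix g).adjugate) := by
        rw [Matrix.mul_adjugate, det_toMatrix, one_smul, mul_one]
    _ = (toMatrix g).adjugate := by rw [← mul_assoc, h, one_mul]

theorem toMatrix_one_one (g : SU2) : toMatrix g 1 1 = star (toMatrix g 0 0) := by
  have := congr_fun (congr_fun (star_toMatrix g) 0) 0
  simpa [Matrix.adjugate_fin_two] using this.symm

theorem toMatrix_one_zero (g : SU2) : toMatrix g 1 0 = -star (toMatrix g 0 1) := by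
  have := congr_fun (congr_fun (star_toMatrix g) 1) 0
  simp only [Matrix.star_apply, Matrix.adjugate_fin_two, Matrix.of_apply, Matrix.cons_val_one,
    Matrix.cons_val_zero] at this
  rw [this, neg_neg]

/-- The quaternion corresponding to an element of `SU2`, as a bare function. -/
noncomputable def quaternionOf (g : SU2) : ℍ :=
  ⟨(toMatrix g 0 0).re, (toMatrix g 0 0).im, (toMatrix g 0 1).re, (toMatrix g 0 1).im⟩

@[simp] theorem re_quaternionOf (g : SU2) : (quaternionOf g).re = (toMatrix g 0 0).re := rfl

@[simp] theorem imI_quaternionOf (g : SU2) : (quaternionOf g).imI = (toMatrix g 0 0).im := rfl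

@[simp] theorem imJ_quaternionOf (g : SU2) : (quaternionOf g).imJ = (toMatrix g 0 1).re := rfl

@[simp] theorem imK_quaternionOf (g : SU2) : (quaternionOf g).imK = (toMatrix g 0 1).im := rfl

/-- The embedding of `SU2` into the quaternions. -/
noncomputable def toQuaternion : SU2 →* ℍ where
  toFun := quaternionOf
  map_one' := by ext <;> simp [toMatrix_one]
  map_mul' g h := by
    ext <;> simp [toMatrix_mul, Matrix.mul_apply, toMatrix_one_one, toMatrix_one_zero] <;> ring

theorem toQuaternion_apply (g : SU2) : toQuaternion g = quaternionOf g := rfl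

theorem toQuaternion_injective : Function.Injective toQuaternion := by
  intro g h hgh
  have h0 : toMatrix g 0 0 = toMatrix h 0 0 :=
    Complex.ext (congr_arg (·.re) hgh) (congr_arg (·.imI) hgh)
  have h1 : toMatrix g 0 1 = toMatrix h 0 1 :=
    Complex.ext (congr_arg (·.imJ) hgh) (congr_arg (·.imK) hgh)
  apply toMatrix_injective
  ext i j
  fin_cases i <;> fin_cases j <;> simp [toMatrix_one_one, toMatrix_one_zero, h0, h1]

theorem norm_toQuaternion (g : SU2) : ‖toQuaternion g‖ = 1 := by
  have h := congr_arg Complex.re (det_toMatrix g)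
  rw [Matrix.det_fin_two, toMatrix_one_one, toMatrix_one_zero] at h
  rw [← sq_eq_sq₀ (norm_nonneg _) zero_le_one, sq, ← Quaternion.normSq_eq_norm_mul_self,
    Quaternion.normSq_def']
  simp only [Complex.star_def, mul_neg, sub_neg_eq_add, Complex.add_re, Complex.mul_re,
    Complex.conj_re, Complex.conj_im, Complex.one_re] at h
  simp only [toQuaternion_apply, re_quaternionOf, imI_quaternionOf, imJ_quaternionOf,
    imK_quaternionOf]
  linarith

/-- The element of `SU2` corresponding to a unit quaternion. -/
noncomputable def ofUnitQuaternion (q : Metric.sphere (0 : ℍ) 1) : SU2 := by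
  let M : Matrix (Fin 2) (Fin 2) ℂ := !![⟨q.1.re, q.1.imI⟩, ⟨q.1.imJ, q.1.imK⟩;
    ⟨-q.1.imJ, q.1.imK⟩, ⟨q.1.re, -q.1.imI⟩]
  have hq : q.1.re ^ 2 + q.1.imI ^ 2 + q.1.imJ ^ 2 + q.1.imK ^ 2 = 1 := by
    rw [← Quaternion.normSq_def', Quaternion.normSq_eq_norm_mul_self, norm_eq_of_mem_sphere]
    simp
  refine ⟨⟨M, Matrix.mem_unitaryGroup_iff.2 ?_⟩, ?_⟩
  · ext i j
    fin_cases i <;> fin_cases j <;> apply Complex.ext <;>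
      simp [M, Matrix.mul_apply, Matrix.star_eq_conjTranspose] <;> linarith
  · show M.det = 1
    rw [Matrix.det_fin_two]
    apply Complex.ext <;> simp [M] <;> linarith

theorem toQuaternion_ofUnitQuaternion (q : Metric.sphere (0 : ℍ) 1) :
    toQuaternion (ofUnitQuaternion q) = q := rfl

theorem continuous_ofUnitQuaternion : Continuous ofUnitQuaternion := by
  refine Continuous.subtype_mk (Continuous.subtype_mk (continuous_matrix fun i j => ?_) _) _
  have h (a b : ℍ → ℝ) (ha : Continuous a) (hb : Continuous b) :
      Continuous fun q : Metric.sphere (0 : ℍ) 1 => (⟨a q, b q⟩ : ℂ) :=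
    Complex.equivRealProdCLM.symm.continuous.comp
      ((ha.comp continuous_subtype_val).prodMk (hb.comp continuous_subtype_val))
  have hr := Quaternion.continuous_re
  have hi := Quaternion.continuous_imI
  have hj := Quaternion.continuous_imJ
  have hk := Quaternion.continuous_imK
  fin_cases i <;> fin_cases j
  exacts [h _ _ hr hi, h _ _ hj hk, h _ _ hj.neg hk, h _ _ hr hi.neg]

theorem compactSpace : CompactSpace SU2 := by
  have : CompactSpace (Metric.sphere (0 : ℍ) 1) :=
    isCompact_iff_compactSpace.1 (isCompact_sphere 0 1)
  refine Function.Surjective.compactSpace (f := ofUnitQuaternion)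
    continuous_ofUnitQuaternion (fun g => ?_)
  exact ⟨⟨toQuaternion g, by simp [norm_toQuaternion]⟩, toQuaternion_injective rfl⟩

theorem re_toQuaternion (g : SU2) : (toQuaternion g).re = (trace g).re / 2 := by
  simp [toQuaternion_apply, trace, Matrix.trace_fin_two, toMatrix_one_one]

theorem trace_conj (u g : SU2) : trace (u⁻¹ * g * u) = trace g := by
  unfold trace
  rw [toMatrix_mul, Matrix.trace_mul_comm, ← toMatrix_mul]
  congr 2
  group

theorem continuous_trace : Continuous trace :=
  (continuous_subtype_val.comp continuous_subtype_val).matrix_trace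

theorem lift_conj {n : ℕ} (u : SU2) (g : Fin n → SU2) (w : FreeGroup (Fin n)) :
    FreeGroup.lift (fun i => u⁻¹ * g i * u) w = u⁻¹ * FreeGroup.lift g w * u := by
  have h : FreeGroup.lift (fun i => u⁻¹ * g i * u) =
      (MulAut.conj u⁻¹).toMonoidHom.comp (FreeGroup.lift g) := by
    ext i
    simp
  simp [h]

theorem continuous_lift {n : ℕ} (w : FreeGroup (Fin n)) :
    Continuous fun g : Fin n → SU2 => FreeGroup.lift g w := by
  induction w using FreeGroup.induction_on with
  | C1 => simpa using continuous_const
  | of i => simpa using continuous_apply i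
  | inv_of i h => simp only [map_inv]; exact Continuous.inv h
  | mul x y hx hy => simp only [map_mul]; exact Continuous.mul hx hy

/-- Tuples in `SU2` whose words have the same traces are simultaneously conjugate. -/
theorem exists_conj_of_trace_lift_eq {n : ℕ} (g h : Fin n → SU2)
    (hgh : ∀ w, trace (FreeGroup.lift g w) = trace (FreeGroup.lift h w)) :
    ∃ u : SU2, (fun i => u⁻¹ * g i * u) = h := by
  obtain ⟨q, hq0, hq⟩ := Quaternion.exists_intertwiner_of_re_eq
    (toQuaternion.comp (FreeGroup.lift g)) (toQuaternion.comp (FreeGroup.lift h))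
    (fun _ => norm_toQuaternion _) (fun _ => norm_toQuaternion _)
    (fun w => by simp [re_toQuaternion, hgh w])
  let p : Metric.sphere (0 : ℍ) 1 := ⟨‖q‖⁻¹ • q, by simp [norm_smul, hq0]⟩
  refine ⟨ofUnitQuaternion p, funext fun i => ?_⟩
  rw [mul_assoc, inv_mul_eq_iff_eq_mul]
  apply toQuaternion_injective
  have := hq (FreeGroup.of i)
  simp only [MonoidHom.comp_apply, FreeGroup.lift_apply_of] at this
  rw [map_mul, map_mul, toQuaternion_ofUnitQuaternion, mul_smul_comm, smul_mul_assoc, this]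

end SU2

/-- The closure (in the uniform topology) of the star-subalgebra of `C(SU(2)ⁿ, ℂ)`
generated by the trace-of-word functions `g ↦ Tr(φ_g(w))`, `w ∈ FreeGroup (Fin n)`,
is exactly the set of continuous functions invariant under simultaneous conjugation. -/
theorem trace_word_functions_generate_ad_invariant_functions (n : ℕ) :
    closure ((StarAlgebra.adjoin ℂ
        {f : C((Fin n → SU2), ℂ) |
          ∃ w : FreeGroup (Fin n), ∀ g : Fin n → SU2,
            f g = SU2.trace (FreeGroup.lift g w)} : StarSubalgebra ℂ C((Fin n → SU2), ℂ))
      : Set C((Fin n → SU2), ℂ))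
    = {f : C((Fin n → SU2), ℂ) |
        ∀ (u : SU2) (g : Fin n → SU2), f (fun i => u⁻¹ * g i * u) = f g} := by
  have := SU2.compactSpace
  apply Set.Subset.antisymm
  · refine closure_minimal (fun f hf => ?_) ?_
    · induction hf using StarAlgebra.adjoin_induction with
      | mem f hf =>
        obtain ⟨w, hw⟩ := hf
        intro u g
        rw [hw, hw, SU2.lift_conj, SU2.trace_conj]
      | algebraMap r => exact fun _ _ => rfl
      | add f₁ f₂ _ _ h₁ h₂ => exact fun u g => congr_arg₂ (· + ·) (h₁ u g) (h₂ u g)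
      | mul f₁ f₂ _ _ h₁ h₂ => exact fun u g => congr_arg₂ (· * ·) (h₁ u g) (h₂ u g)
      | star f _ h => exact fun u g => congr_arg star (h u g)
    · simp only [Set.ofPred_forall]
      exact isClosed_iInter fun u => isClosed_iInter fun g =>
        isClosed_eq (continuous_eval_const _) (continuous_eval_const _)
  · intro f hf
    refine ContinuousMap.mem_closure_starSubalgebra _ f fun g h hgh => ?_
    obtain ⟨u, rfl⟩ := SU2.exists_conj_of_trace_lift_eq g h fun w =>
      hgh ⟨_, SU2.continuous_trace.comp (SU2.continuous_lift w)⟩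
        (StarAlgebra.subset_adjoin ℂ _ ⟨w, fun _ => rfl⟩)
    exact (hf u g).symm
end

section
/- Let X be a topological space and let A be a closed unital star-subalgebra of the C*-algebra of bounded continuous complex-valued functions on X (with the sup norm, pointwise operations and complex-conjugation as the star operation). For each x ∈ X, evaluation at x defines a character ev_x of A (a nonzero algebra homomorphism A → ℂ). Then the set {ev_x : x ∈ X} is dense in the character space of A (equipped with the weak-* topology). -/
open WeakDual

/-- Evaluation at a point, as a character of a star-subalgebra of bounded continuous functions. -/
noncomputable def StarSubalgebra.evalCharacter {X : Type*} [TopologicalSpace X]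
    (A : StarSubalgebra ℂ (BoundedContinuousFunction X ℂ)) (x : X) : characterSpace ℂ A :=
  ⟨((BoundedContinuousFunction.evalCLM ℂ x).comp
      A.toSubalgebra.toSubmodule.subtypeL : A →L[ℂ] ℂ),
    fun h => one_ne_zero (α := ℂ) (DFunLike.congr_fun h (1 : A)),
    fun _ _ => rfl⟩

theorem StarSubalgebra.evalCharacter_apply {X : Type*} [TopologicalSpace X]
    (A : StarSubalgebra ℂ (BoundedContinuousFunction X ℂ)) (x : X) (a : A) :
    A.evalCharacter x a = (a : BoundedContinuousFunction X ℂ) x :=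
  rfl

/-- For a closed unital star-subalgebra `A` of the C*-algebra of bounded continuous
complex-valued functions on a topological space `X`, the characters given by evaluation
at points of `X` form a dense subset of the character space of `A`. -/
theorem point_evaluations_dense_in_characterSpace
    {X : Type*} [TopologicalSpace X]
    (A : StarSubalgebra ℂ (BoundedContinuousFunction X ℂ))
    (hA : IsClosed (A : Set (BoundedContinuousFunction X ℂ))) :
    Dense {φ : characterSpace ℂ A |
      ∃ x : X, ∀ a : A, φ a = (a : BoundedContinuousFunction X ℂ) x} := by
  have : CompleteSpace A := hA.completeSpace_coe
  let _ : CommCStarAlgebra A := { }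
  intro φ
  by_contra hφ
  obtain ⟨f, hf₀, hf₁, -⟩ := exists_continuous_zero_one_of_isClosed isClosed_closure
    isClosed_singleton (Set.disjoint_singleton_right.mpr hφ)
  obtain ⟨a, ha⟩ := (gelfandTransform_bijective A).surjective
    ((⟨Complex.ofReal, Complex.continuous_ofReal⟩ : C(ℝ, ℂ)).comp f)
  have hψ (ψ : characterSpace ℂ A) : ψ a = (f ψ : ℂ) := DFunLike.congr_fun ha ψ
  have ha₀ : a = 0 := by
    ext x
    have hx := hψ (A.evalCharacter x)
    rw [hf₀ (subset_closure ⟨x, A.evalCharacter_apply x⟩)] at hx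
    simpa [A.evalCharacter_apply] using hx
  have h₁ := hψ φ
  rw [ha₀, hf₁ rfl] at h₁
  simp at h₁
end
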